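/- arXiv:2501.19315 — 4 statements merged into one kernel-verified Lean document; each statement's English description precedes it below -/
import Mathlib

section
/- Fix ε > 0, δ ∈ (0, 1/2], Δ > 0, and positive integers m, n. Set σ = Δ/ε and s = (Δ/ε)·log(mn(e^ε − 1)/δ + 1). Let Z be an m×n random matrix whose entries are independent, each distributed with the truncated Laplace density with scale σ and support [−s, s]. Then for any two matrices A, A′ ∈ ℝ^{m×n} with ‖A − A′‖_{1,1} ≤ Δ and every Borel set T ⊆ ℝ^{m×n}, one has P[A + Z ∈ T] ≤ e^ε · P[A′ + Z ∈ T] + δ. (Matrix-Variate Truncated Laplace Mechanism is (ε, δ)-differentially private.) -/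
open MeasureTheory

/-- The truncated Laplace density with scale `σ` and support `[-s, s]`:
`f(z) = ζ⁻¹ · exp (-|z|/σ)` for `|z| ≤ s` and `0` otherwise, where
`ζ = 2σ(1 - exp (-s/σ))`. -/
noncomputable def truncLapPdf (σ s z : ℝ) : ℝ :=
  if |z| ≤ s then Real.exp (-|z| / σ) / (2 * σ * (1 - Real.exp (-s / σ))) else 0

/-- The law of a real random variable with the truncated Laplace density. -/
noncomputable def truncLap (σ s : ℝ) : Measure ℝ :=
  volume.withDensity fun z => ENNReal.ofReal (truncLapPdf σ s z)

/-- Domination of the factors up to constants gives domination of the product measures. -/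
theorem pi_le_prod_smul_pi {ι : Type*} [Fintype ι] {α : ι → Type*}
    [∀ i, MeasurableSpace (α i)] (μ ν : ∀ i, Measure (α i))
    [∀ i, IsFiniteMeasure (μ i)] [∀ i, IsFiniteMeasure (ν i)] (c : ι → NNReal)
    (h : ∀ i, μ i ≤ c i • ν i) : Measure.pi μ ≤ (∏ i, c i) • Measure.pi ν := by
  have key : (∏ i, c i) • Measure.pi ν = Measure.pi fun i => c i • ν i := by
    symm
    refine Measure.pi_eq fun t _ => ?_
    simp only [Measure.smul_apply, Measure.pi_pi, ENNReal.smul_def, smul_eq_mul,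
      Finset.prod_mul_distrib, ENNReal.ofNNReal_finsetProd]
  rw [key, ← Measure.toOuterMeasure_le]
  have hpi : OuterMeasure.pi (fun i => (c i • ν i).toOuterMeasure)
      ≤ (Measure.pi fun i => c i • ν i).toOuterMeasure := by
    rw [Measure.pi]
    exact fun t => le_toMeasure_apply _ _ t
  refine le_trans (OuterMeasure.le_pi.2 ?_) hpi
  intro t _
  refine (Measure.pi_pi μ t).le.trans ?_
  exact Finset.prod_le_prod' fun i _ => h i (t i)

theorem measurable_truncLapPdf (σ s : ℝ) : Measurable (truncLapPdf σ s) := by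
  unfold truncLapPdf
  exact Measurable.ite (measurableSet_le (by fun_prop) (by fun_prop)) (by fun_prop) (by fun_prop)

theorem one_sub_exp_neg_div_pos {σ s : ℝ} (hσ : 0 < σ) (hs : 0 < s) :
    0 < 1 - Real.exp (-s / σ) := by
  have : -s / σ < 0 := div_neg_of_neg_of_pos (by linarith) hσ
  linarith [Real.exp_lt_one_iff.2 this]

theorem measurePreserving_neg_truncLap (σ s : ℝ) :
    MeasurePreserving (fun z : ℝ => -z) (truncLap σ s) (truncLap σ s) := by
  refine ⟨measurable_neg, ?_⟩
  ext t ht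
  have hm := (measurable_truncLapPdf σ s).ennreal_ofReal
  rw [Measure.map_apply measurable_neg ht, truncLap, withDensity_apply _ (measurable_neg ht),
    withDensity_apply _ ht,
    ← (Measure.measurePreserving_neg (volume : Measure ℝ)).setLIntegral_comp_preimage ht hm]
  simp only [truncLapPdf, abs_neg]

theorem truncLap_Ioc {σ s a : ℝ} (hσ : 0 < σ) (hs : 0 < s) (ha : 0 ≤ a) (has : a ≤ s) :
    truncLap σ s (Set.Ioc a s)
      = ENNReal.ofReal ((Real.exp (-a / σ) - Real.exp (-s / σ))
        / (2 * (1 - Real.exp (-s / σ)))) := by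
  have hpos := one_sub_exp_neg_div_pos hσ hs
  rw [truncLap, withDensity_apply _ measurableSet_Ioc]
  have h1 : ∫⁻ z in Set.Ioc a s, ENNReal.ofReal (truncLapPdf σ s z)
      = ∫⁻ z in Set.Ioc a s,
        ENNReal.ofReal (Real.exp (-z / σ) / (2 * σ * (1 - Real.exp (-s / σ)))) := by
    refine setLIntegral_congr_fun measurableSet_Ioc fun z hz => ?_
    have hz0 : |z| = z := abs_of_pos (lt_of_le_of_lt ha hz.1)
    simp [truncLapPdf, hz0, hz.2]
  have hc : Continuous fun z : ℝ =>
      Real.exp (-z / σ) / (2 * σ * (1 - Real.exp (-s / σ))) := by fun_prop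
  rw [h1, ← ofReal_integral_eq_lintegral_ofReal, ← intervalIntegral.integral_of_le has]
  · congr 1
    have hd : ∀ z ∈ Set.uIcc a s, HasDerivAt
        (fun z : ℝ => -Real.exp (-z / σ) / (2 * (1 - Real.exp (-s / σ))))
        (Real.exp (-z / σ) / (2 * σ * (1 - Real.exp (-s / σ)))) z := by
      intro z _
      have h := ((((hasDerivAt_id z).neg.div_const σ).exp).neg).div_const
        (2 * (1 - Real.exp (-s / σ)))
      refine h.congr_deriv ?_
      simp only [Pi.neg_apply, id]
      field_simp
    rw [intervalIntegral.integral_eq_sub_of_hasDerivAt hd (hc.intervalIntegrable _ _)]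
    ring
  · exact (hc.integrableOn_Icc).mono_set Set.Ioc_subset_Icc_self
  · exact Filter.Eventually.of_forall fun z => by positivity

theorem truncLap_lt_abs (σ s : ℝ) : truncLap σ s {z | s < |z|} = 0 := by
  have hm : MeasurableSet {z : ℝ | s < |z|} := measurableSet_lt (by fun_prop) (by fun_prop)
  rw [truncLap, withDensity_apply _ hm]
  rw [setLIntegral_congr_fun (g := fun _ => 0) hm]
  · simp
  · intro z hz
    have hz' : s < |z| := hz
    simp [truncLapPdf, not_le.2 hz']

theorem isProbabilityMeasure_truncLap {σ s : ℝ} (hσ : 0 < σ) (hs : 0 < s) :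
    IsProbabilityMeasure (truncLap σ s) := by
  constructor
  have hpos := one_sub_exp_neg_div_pos hσ hs
  have hhalf : truncLap σ s (Set.Ioc 0 s) = ENNReal.ofReal (1 / 2) := by
    rw [truncLap_Ioc hσ hs le_rfl hs.le]
    congr 1
    rw [neg_zero, zero_div, Real.exp_zero, mul_comm, div_mul_eq_div_div, div_self hpos.ne']
  have hpos_half : truncLap σ s (Set.Ioi 0) = ENNReal.ofReal (1 / 2) := by
    refine le_antisymm ?_ (hhalf ▸ measure_mono Set.Ioc_subset_Ioi_self)
    have hsub : Set.Ioi 0 ⊆ Set.Ioc 0 s ∪ {z : ℝ | s < |z|} := by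
      intro z hz
      by_cases h : z ≤ s
      · exact Or.inl ⟨hz, h⟩
      · exact Or.inr ((not_le.1 h).trans_le (le_abs_self z))
    refine (measure_mono hsub).trans ((measure_union_le _ _).trans ?_)
    rw [hhalf, truncLap_lt_abs, add_zero]
  have hneg_half : truncLap σ s (Set.Iio 0) = ENNReal.ofReal (1 / 2) := by
    rw [← hpos_half, ← (measurePreserving_neg_truncLap σ s).measure_preimage
      measurableSet_Ioi.nullMeasurableSet]
    congr 1
    ext z
    simp
  have hzero : truncLap σ s {0} = 0 :=
    withDensity_absolutelyContinuous _ _ (measure_singleton 0)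
  have hIci : truncLap σ s (Set.Ici 0) = ENNReal.ofReal (1 / 2) := by
    refine le_antisymm ?_ (hpos_half ▸ measure_mono Set.Ioi_subset_Ici_self)
    rw [← Set.Ioi_union_left]
    refine (measure_union_le _ _).trans ?_
    rw [hzero, hpos_half, add_zero]
  rw [← measure_add_measure_compl (measurableSet_Ici (a := (0 : ℝ))), Set.compl_Ici, hIci,
    hneg_half, ← ENNReal.ofReal_add (by norm_num) (by norm_num)]
  norm_num

/-- Mass lost when the support is shifted by `d`. -/
theorem truncLap_lt_abs_add_le {σ s d D : ℝ} (hσ : 0 < σ) (hs : 0 < s) (hd : |d| ≤ D)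
    (hD : D ≤ s) :
    truncLap σ s {z | s < |z + d|}
      ≤ ENNReal.ofReal ((Real.exp (-(s - D) / σ) - Real.exp (-s / σ))
        / (2 * (1 - Real.exp (-s / σ)))) := by
  have hD0 : 0 ≤ D := (abs_nonneg d).trans hd
  have nonneg_case : ∀ e : ℝ, 0 ≤ e → e ≤ D →
      truncLap σ s {z | s < |z + e|} ≤ truncLap σ s (Set.Ioc (s - D) s) := by
    intro e he heD
    have hsub : {z : ℝ | s < |z + e|} ⊆ Set.Ioc (s - D) s ∪ {z : ℝ | s < |z|} := by
      intro z hz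
      by_cases h : |z| ≤ s
      · left
        have h' := abs_le.1 h
        rcases lt_abs.1 (show s < |z + e| from hz) with h1 | h1
        · exact ⟨by linarith, h'.2⟩
        · linarith
      · exact Or.inr (not_le.1 h)
    refine (measure_mono hsub).trans ((measure_union_le _ _).trans ?_)
    rw [truncLap_lt_abs, add_zero]
  rw [← truncLap_Ioc hσ hs (by linarith) (by linarith : s - D ≤ s)]
  rcases le_total 0 d with h | h
  · exact nonneg_case d h ((le_abs_self d).trans hd)
  · have hm : MeasurableSet {z : ℝ | s < |z + -d|} :=
      measurableSet_lt (by fun_prop) (by fun_prop)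
    have heq : {z : ℝ | s < |z + d|} = (fun z => -z) ⁻¹' {z : ℝ | s < |z + -d|} := by
      ext z
      simp only [Set.mem_preimage, Set.mem_ofPred_eq]
      rw [← abs_neg (z + d), neg_add]
    rw [heq, (measurePreserving_neg_truncLap σ s).measure_preimage hm.nullMeasurableSet]
    exact nonneg_case (-d) (by linarith) ((neg_le_abs d).trans hd)

theorem truncLapPdf_le_exp_mul {σ s d z : ℝ} (hσ : 0 < σ) (hs : 0 < s) (hz : |z + d| ≤ s) :
    truncLapPdf σ s z ≤ Real.exp (|d| / σ) * truncLapPdf σ s (z + d) := by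
  have hpos := one_sub_exp_neg_div_pos hσ hs
  have hright : Real.exp (-|z| / σ) ≤ Real.exp (|d| / σ) * Real.exp (-|z + d| / σ) := by
    rw [← Real.exp_add, ← add_div]
    gcongr
    linarith [abs_add_le z d]
  simp only [truncLapPdf, hz, if_true]
  split_ifs
  · rw [← mul_div_assoc]
    gcongr
  · positivity

theorem restrict_truncLap_le {σ s d : ℝ} (hσ : 0 < σ) (hs : 0 < s) :
    (truncLap σ s).restrict {z | |z + d| ≤ s}
      ≤ Real.toNNReal (Real.exp (|d| / σ)) • (truncLap σ s).map (fun z => z - d) := by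
  have hm := (measurable_truncLapPdf σ s).ennreal_ofReal
  have hG : MeasurableSet {z : ℝ | |z + d| ≤ s} := measurableSet_le (by fun_prop) (by fun_prop)
  have hsub : Measurable fun z : ℝ => z - d := by fun_prop
  have hcomp : Measurable fun z : ℝ => ENNReal.ofReal (truncLapPdf σ s (z + d)) :=
    hm.comp (measurable_add_const d)
  refine Measure.le_iff.2 fun t ht => ?_
  have hmap : (truncLap σ s).map (fun z => z - d) t
      = ∫⁻ z in t, ENNReal.ofReal (truncLapPdf σ s (z + d)) := by
    rw [Measure.map_apply hsub ht, truncLap, withDensity_apply _ (hsub ht),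
      ← (measurePreserving_add_right (volume : Measure ℝ) d).setLIntegral_comp_preimage
        (hsub ht) hm]
    congr 2
    ext z
    simp
  rw [Measure.restrict_apply ht, Measure.smul_apply, hmap, ENNReal.smul_def, smul_eq_mul,
    ← lintegral_const_mul _ hcomp, truncLap, withDensity_apply _ (ht.inter hG)]
  refine (setLIntegral_mono (by fun_prop) fun z hz => ?_).trans
    (lintegral_mono_set Set.inter_subset_left)
  change _ ≤ ENNReal.ofReal (Real.exp (|d| / σ)) * _
  rw [← ENNReal.ofReal_mul (Real.exp_pos _).le]
  exact ENNReal.ofReal_le_ofReal (truncLapPdf_le_exp_mul hσ hs hz.2)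

/-- The Matrix-Variate Truncated Laplace Mechanism is `(ε, δ)`-differentially private. -/
theorem matrix_truncated_laplace_dp
    (ε δ Δ : ℝ) (hε : 0 < ε) (hδ0 : 0 < δ) (hδ : δ ≤ 1 / 2) (hΔ : 0 < Δ)
    (m n : ℕ) (hm : 0 < m) (hn : 0 < n)
    (σ s : ℝ) (hσ : σ = Δ / ε)
    (hs : s = Δ / ε * Real.log ((m * n : ℝ) * (Real.exp ε - 1) / δ + 1))
    (μZ : Measure (Fin m → Fin n → ℝ))
    (hμZ : μZ = Measure.pi fun _ : Fin m => Measure.pi fun _ : Fin n => truncLap σ s)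
    (A A' : Fin m → Fin n → ℝ)
    (hsens : ∑ i, ∑ j, |A i j - A' i j| ≤ Δ)
    (T : Set (Fin m → Fin n → ℝ)) (hT : MeasurableSet T) :
    μZ {z | A + z ∈ T} ≤ ENNReal.ofReal (Real.exp ε) * μZ {z | A' + z ∈ T}
      + ENNReal.ofReal δ := by
  have hσ0 : 0 < σ := hσ ▸ div_pos hΔ hε
  have hexp : 0 < Real.exp ε - 1 := by linarith [Real.add_one_lt_exp hε.ne']
  have hK : (1 : ℝ) ≤ (m * n : ℝ) := by exact_mod_cast Nat.mul_pos hm hn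
  set K : ℝ := (m * n : ℝ) with hKdef
  have hR : 0 < K * (Real.exp ε - 1) / δ := by positivity
  rw [← hσ] at hs
  have hsσ : Real.exp (s / σ) = K * (Real.exp ε - 1) / δ + 1 := by
    rw [hs, mul_div_cancel_left₀ _ hσ0.ne', Real.exp_log (by linarith)]
  have hs0 : 0 < s := hs ▸ mul_pos hσ0 (Real.log_pos (by linarith))
  have hΔσ : Δ / σ = ε := by rw [hσ]; field_simp
  have hΔs : Δ ≤ s := by
    have : Real.exp (Δ / σ) ≤ Real.exp (s / σ) := by
      rw [hΔσ, hsσ]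
      have : Real.exp ε - 1 ≤ K * (Real.exp ε - 1) / δ := by
        rw [le_div_iff₀ hδ0, mul_comm]
        gcongr
        linarith
      linarith
    exact (div_le_div_iff_of_pos_right hσ0).1 (Real.exp_le_exp.1 this)
  have hprob := isProbabilityMeasure_truncLap hσ0 hs0
  set d : Fin m → Fin n → ℝ := fun i j => A i j - A' i j with hd
  have hdΔ : ∀ i j, |d i j| ≤ Δ := fun i j =>
    ((Finset.single_le_sum (f := fun j => |d i j|) (fun _ _ => abs_nonneg _)
      (Finset.mem_univ j)).trans
      (Finset.single_le_sum (f := fun i => ∑ j, |d i j|)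
        (fun _ _ => Finset.sum_nonneg fun _ _ => abs_nonneg _) (Finset.mem_univ i))).trans hsens
  have htail : (Real.exp (-(s - Δ) / σ) - Real.exp (-s / σ)) / (2 * (1 - Real.exp (-s / σ)))
      ≤ δ / K := by
    have h1 : Real.exp (-(s - Δ) / σ) = Real.exp ε * Real.exp (-s / σ) := by
      rw [← Real.exp_add, ← hΔσ]
      congr 1
      ring
    have h2 : Real.exp (-s / σ) = (K * (Real.exp ε - 1) / δ + 1)⁻¹ := by
      rw [neg_div, Real.exp_neg, hsσ]
    have h3 : (Real.exp (-(s - Δ) / σ) - Real.exp (-s / σ)) / (2 * (1 - Real.exp (-s / σ)))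
        = δ / K / 2 := by
      have hK0 : K ≠ 0 := by positivity
      have hq : K * (Real.exp ε - 1) / δ + 1 ≠ 0 := by positivity
      set E := Real.exp ε - 1 with hE
      have hE' : Real.exp ε = E + 1 := by rw [hE]; ring
      rw [h1, h2, hE', show (1 : ℝ) - (K * E / δ + 1)⁻¹ = (K * E / δ) * (K * E / δ + 1)⁻¹ by
        field_simp; ring]
      field_simp
      ring
    rw [h3]
    exact half_le_self (by positivity)
  let G : Set (Fin m → Fin n → ℝ) :=
    Set.univ.pi fun i => Set.univ.pi fun j => {z | |z + d i j| ≤ s}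
  have hbad : μZ Gᶜ ≤ ENNReal.ofReal δ := by
    have hsub : Gᶜ ⊆ ⋃ i, ⋃ j, (fun z : Fin m → Fin n → ℝ => z i j) ⁻¹' {z | s < |z + d i j|} := by
      intro z hz
      simpa [G, Set.mem_pi] using hz
    have heval : ∀ i j, μZ ((fun z : Fin m → Fin n → ℝ => z i j) ⁻¹' {z | s < |z + d i j|})
        ≤ ENNReal.ofReal (δ / K) := by
      intro i j
      have hmeas : MeasurableSet {z : ℝ | s < |z + d i j|} :=
        measurableSet_lt (by fun_prop) (by fun_prop)
      have hmp : MeasurePreserving (fun z : Fin m → Fin n → ℝ => z i j) μZ (truncLap σ s) := by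
        rw [hμZ]
        exact (measurePreserving_eval (fun _ : Fin n => truncLap σ s) j).comp
          (measurePreserving_eval
            (fun _ : Fin m => Measure.pi fun _ : Fin n => truncLap σ s) i)
      rw [hmp.measure_preimage hmeas.nullMeasurableSet]
      exact (truncLap_lt_abs_add_le hσ0 hs0 (hdΔ i j) hΔs).trans (ENNReal.ofReal_le_ofReal htail)
    calc μZ Gᶜ ≤ ∑ i, ∑ j, μZ ((fun z : Fin m → Fin n → ℝ => z i j) ⁻¹' {z | s < |z + d i j|}) := by
          refine (measure_mono hsub).trans ((measure_iUnion_fintype_le _ _).trans ?_)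
          exact Finset.sum_le_sum fun i _ => measure_iUnion_fintype_le _ _
      _ ≤ ∑ _i : Fin m, ∑ _j : Fin n, ENNReal.ofReal (δ / K) :=
          Finset.sum_le_sum fun i _ => Finset.sum_le_sum fun j _ => heval i j
      _ = ENNReal.ofReal (K * (δ / K)) := by
          rw [ENNReal.ofReal_mul (by positivity), hKdef, ENNReal.ofReal_mul (by positivity)]
          simp [mul_assoc]
      _ = ENNReal.ofReal δ := by rw [mul_div_cancel₀ _ (by positivity)]
  let c : Fin m → Fin n → NNReal := fun i j => Real.toNNReal (Real.exp (|d i j| / σ))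
  let τ : (Fin m → Fin n → ℝ) → Fin m → Fin n → ℝ := fun z i j => z i j - d i j
  have hτ : Measurable τ := by fun_prop
  have hτmap : Measure.pi (fun i => Measure.pi fun j => (truncLap σ s).map fun z => z - d i j)
      = μZ.map τ := by
    have hpm : ∀ i j, IsProbabilityMeasure ((truncLap σ s).map fun z => z - d i j) :=
      fun i j => Measure.isProbabilityMeasure_map (by fun_prop)
    have hrow : ∀ i, (Measure.pi fun j => (truncLap σ s).map fun z => z - d i j)
        = (Measure.pi fun _ : Fin n => truncLap σ s).map fun x j => x j - d i j := fun i =>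
      (Measure.pi_map_pi (μ := fun _ : Fin n => truncLap σ s)
        (f := fun j z => z - d i j) fun j => by fun_prop).symm
    have hsub : ∀ i, Measurable fun (x : Fin n → ℝ) j => x j - d i j := fun i => by fun_prop
    have hpr : ∀ i, IsProbabilityMeasure
        ((Measure.pi fun _ : Fin n => truncLap σ s).map fun x j => x j - d i j) :=
      fun i => Measure.isProbabilityMeasure_map (hsub i).aemeasurable
    simp_rw [hrow, hμZ]
    exact (Measure.pi_map_pi (μ := fun _ : Fin m => Measure.pi fun _ : Fin n => truncLap σ s)
        (f := fun i x j => x j - d i j) fun i => (hsub i).aemeasurable).symm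
  have hdom : μZ.restrict G ≤ (∏ i, ∏ j, c i j) • μZ.map τ := by
    have hpm : ∀ i j, IsProbabilityMeasure ((truncLap σ s).map fun z => z - d i j) :=
      fun i j => Measure.isProbabilityMeasure_map (by fun_prop)
    rw [hμZ, Measure.restrict_pi_pi, ← hμZ, ← hτmap]
    refine pi_le_prod_smul_pi _ _ _ fun i => ?_
    rw [Measure.restrict_pi_pi]
    exact pi_le_prod_smul_pi _ _ _ fun j => restrict_truncLap_le hσ0 hs0
  have hc : ((∏ i, ∏ j, c i j : NNReal) : ENNReal) ≤ ENNReal.ofReal (Real.exp ε) := by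
    refine ENNReal.coe_le_coe.2 ?_
    rw [← NNReal.coe_le_coe, Real.coe_toNNReal _ (Real.exp_pos _).le]
    push_cast
    simp only [c, Real.coe_toNNReal _ (Real.exp_pos _).le, ← Real.exp_sum, ← Finset.sum_div]
    rw [← hΔσ]
    gcongr
  have hT' : MeasurableSet {z | A + z ∈ T} := (measurable_const_add A) hT
  have hshift : τ ⁻¹' {z | A + z ∈ T} = {z | A' + z ∈ T} := by
    ext z
    have : A + τ z = A' + z := by
      ext i j
      simp only [τ, hd, Pi.add_apply]
      ring
    simp only [Set.mem_preimage, Set.mem_ofPred_eq, this]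
  have hgood : μZ ({z | A + z ∈ T} ∩ G) ≤ ENNReal.ofReal (Real.exp ε) * μZ {z | A' + z ∈ T} := by
    rw [← Measure.restrict_apply hT', ← hshift, ← Measure.map_apply hτ hT']
    refine (hdom _).trans ?_
    rw [Measure.smul_apply, ENNReal.smul_def, smul_eq_mul]
    gcongr
  calc μZ {z | A + z ∈ T} ≤ μZ ({z | A + z ∈ T} ∩ G ∪ Gᶜ) := by
        refine measure_mono fun z hz => ?_
        by_cases h : z ∈ G
        · exact Or.inl ⟨hz, h⟩
        · exact Or.inr h
    _ ≤ μZ ({z | A + z ∈ T} ∩ G) + μZ Gᶜ := measure_union_le _ _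
    _ ≤ _ := add_le_add hgood hbad
end

section
/- Let X be a type equipped with a symmetric adjacency relation adj, let N be a positive integer, and for each i ∈ {1, …, N} let R_i be a measurable space and M_i : X → ProbabilityMeasure(R_i) a mechanism such that for all adjacent x, x′ ∈ X and every measurable set T_i ⊆ R_i, M_i(x)(T_i) ≤ e^{ε_i}·M_i(x′)(T_i) + δ_i, where ε_i ≥ 0 and δ_i ≥ 0. Then the product mechanism M : X → ProbabilityMeasure(Π_i R_i) given by M(x) = ⨂_i M_i(x) (the product of the component measures, corresponding to independent noise draws) satisfies: for all adjacent x, x′ and every measurable set T ⊆ Π_i R_i, M(x)(T) ≤ e^{Σ_i ε_i}·M(x′)(T) + Σ_i δ_i. In particular, if ε_i = α_i ε and δ_i = α_i δ with α_i ≥ 0 and Σ_i α_i = 1, the product mechanism is (ε, δ)-differentially private. (Sequential composition of differentially private mechanisms.) -/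
open MeasureTheory

namespace MeasureTheory

open scoped ENNReal

/-- A setwise bound `μ T ≤ c * ν T + d` extends from events to `[0, 1]`-valued functions. -/
theorem lintegral_le_mul_add_of_forall_measure_le {α : Type*} [MeasurableSpace α]
    {μ ν : Measure α} {c d : ℝ≥0∞}
    (h : ∀ T, MeasurableSet T → μ T ≤ c * ν T + d)
    {f : α → ℝ≥0∞} (hf : Measurable f) (hf_le : ∀ a, f a ≤ 1) :
    ∫⁻ a, f a ∂μ ≤ c * ∫⁻ a, f a ∂ν + d := by
  have hg : Measurable fun a => (f a).toReal := hf.ennreal_toReal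
  have layercake (ρ : Measure α) :
      ∫⁻ a, f a ∂ρ = ∫⁻ t in Set.Ioi (0 : ℝ), ρ {a | t < (f a).toReal} := by
    rw [← lintegral_eq_lintegral_meas_lt ρ (.of_forall fun _ => ENNReal.toReal_nonneg)
      hg.aemeasurable]
    exact lintegral_congr fun a =>
      (ENNReal.ofReal_toReal (ne_top_of_le_ne_top ENNReal.one_ne_top (hf_le a))).symm
  have hmono : Measurable fun t : ℝ => ν {a | t < (f a).toReal} :=
    Antitone.measurable fun s t hst => measure_mono fun a (ha : t < _) => hst.trans_lt ha
  rw [layercake μ, layercake ν, ← lintegral_const_mul c hmono]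
  calc ∫⁻ t in Set.Ioi (0 : ℝ), μ {a | t < (f a).toReal}
      ≤ ∫⁻ t in Set.Ioi (0 : ℝ),
          (c * ν {a | t < (f a).toReal} + (Set.Iio (1 : ℝ)).indicator (fun _ => d) t) := by
        refine lintegral_mono fun t => ?_
        by_cases ht : t < 1
        · simpa [ht] using h _ (measurableSet_lt measurable_const hg)
        · have hempty : {a | t < (f a).toReal} = ∅ := by
            refine Set.eq_empty_of_forall_notMem fun a (ha : t < _) => ht (ha.trans_le ?_)
            simpa using ENNReal.toReal_mono ENNReal.one_ne_top (hf_le a)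
          simp [hempty]
    _ = (∫⁻ t in Set.Ioi (0 : ℝ), c * ν {a | t < (f a).toReal}) + d := by
        rw [lintegral_add_left (hmono.const_mul c), lintegral_indicator_const measurableSet_Iio,
          Measure.restrict_apply measurableSet_Iio, Set.inter_comm, Set.Ioi_inter_Iio]
        simp

/-- Setwise bounds `μ T ≤ c * ν T + d` compose under binary products. -/
theorem Measure.prod_le_mul_add_of_forall_measure_le {α β : Type*} [MeasurableSpace α]
    [MeasurableSpace β] {μ₁ μ₂ : Measure α} {ν₁ ν₂ : Measure β}
    [IsProbabilityMeasure μ₁] [IsProbabilityMeasure ν₁] [SFinite ν₂]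
    {c₁ c₂ d₁ d₂ : ℝ≥0∞}
    (hμ : ∀ T, MeasurableSet T → μ₁ T ≤ c₁ * μ₂ T + d₁)
    (hν : ∀ T, MeasurableSet T → ν₁ T ≤ c₂ * ν₂ T + d₂)
    {T : Set (α × β)} (hT : MeasurableSet T) :
    μ₁.prod ν₁ T ≤ c₁ * c₂ * μ₂.prod ν₂ T + (d₁ + d₂) := by
  have hmeas : Measurable fun a => ν₂ (Prod.mk a ⁻¹' T) := measurable_measure_prodMk_left hT
  have hfmeas : Measurable fun a => min 1 (c₂ * ν₂ (Prod.mk a ⁻¹' T)) :=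
    measurable_const.min (hmeas.const_mul c₂)
  calc μ₁.prod ν₁ T = ∫⁻ a, ν₁ (Prod.mk a ⁻¹' T) ∂μ₁ := Measure.prod_apply hT
    _ ≤ ∫⁻ a, (min 1 (c₂ * ν₂ (Prod.mk a ⁻¹' T)) + d₂) ∂μ₁ := by
        refine lintegral_mono fun a => ?_
        rw [min_add]
        exact le_min (prob_le_one.trans le_self_add) (hν _ (measurable_prodMk_left hT))
    _ = ∫⁻ a, min 1 (c₂ * ν₂ (Prod.mk a ⁻¹' T)) ∂μ₁ + d₂ := by
        rw [lintegral_add_left hfmeas]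
        simp
    _ ≤ c₁ * ∫⁻ a, min 1 (c₂ * ν₂ (Prod.mk a ⁻¹' T)) ∂μ₂ + d₁ + d₂ := by
        gcongr
        exact lintegral_le_mul_add_of_forall_measure_le hμ hfmeas fun _ => min_le_left _ _
    _ ≤ c₁ * ∫⁻ a, c₂ * ν₂ (Prod.mk a ⁻¹' T) ∂μ₂ + d₁ + d₂ := by
        gcongr
        exact min_le_right _ _
    _ = c₁ * c₂ * μ₂.prod ν₂ T + (d₁ + d₂) := by
        rw [lintegral_const_mul c₂ hmeas, ← Measure.prod_apply hT, mul_assoc, add_assoc]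

/-- Setwise bounds `μ T ≤ c * ν T + d` compose under finite products. -/
theorem Measure.pi_le_mul_add_of_forall_measure_le {n : ℕ} {R : Fin n → Type*}
    [∀ i, MeasurableSpace (R i)] {μ ν : ∀ i, Measure (R i)}
    [∀ i, IsProbabilityMeasure (μ i)] [∀ i, IsProbabilityMeasure (ν i)]
    {c d : Fin n → ℝ≥0∞}
    (h : ∀ i T, MeasurableSet T → μ i T ≤ c i * ν i T + d i)
    {T : Set (∀ i, R i)} (hT : MeasurableSet T) :
    Measure.pi μ T ≤ (∏ i, c i) * Measure.pi ν T + ∑ i, d i := by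
  induction n with
  | zero => simp [Subsingleton.elim μ ν]
  | succ n ih =>
    let e := MeasurableEquiv.piFinSuccAbove R 0
    have hpi (ρ : ∀ i, Measure (R i)) [∀ i, IsProbabilityMeasure (ρ i)] :
        Measure.pi ρ T =
          ((ρ 0).prod (Measure.pi fun i => ρ (Fin.succAbove 0 i))) (e.symm ⁻¹' T) :=
      ((measurePreserving_piFinSuccAbove ρ 0).symm e).measure_preimage_equiv T |>.symm
    rw [hpi μ, hpi ν, Fin.prod_univ_succAbove c 0, Fin.sum_univ_succAbove d 0]
    exact Measure.prod_le_mul_add_of_forall_measure_le (h 0)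
      (fun S hS => ih (fun i => h (Fin.succAbove 0 i)) hS) (e.symm.measurable hT)

end MeasureTheory

/-- Sequential composition of differentially private mechanisms: if each mechanism
`M i` is `(ε i, δ i)`-differentially private, then the product mechanism
`x ↦ ⨂ i, M i x` (independent noise draws) is `(∑ i, ε i, ∑ i, δ i)`-differentially
private. -/
theorem sequential_composition
    {X : Type*} (adj : X → X → Prop) (hadj : Symmetric adj)
    (N : ℕ) (hN : 0 < N)
    (R : Fin N → Type*) [∀ i, MeasurableSpace (R i)]
    (M : ∀ i, X → ProbabilityMeasure (R i))
    (ε δ : Fin N → ℝ) (hε : ∀ i, 0 ≤ ε i) (hδ : ∀ i, 0 ≤ δ i)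
    (hdp : ∀ i, ∀ x x', adj x x' → ∀ T : Set (R i), MeasurableSet T →
      (M i x : Measure (R i)) T
        ≤ ENNReal.ofReal (Real.exp (ε i)) * (M i x' : Measure (R i)) T
          + ENNReal.ofReal (δ i)) :
    ∀ x x', adj x x' → ∀ T : Set (∀ i, R i), MeasurableSet T →
      Measure.pi (fun i => (M i x : Measure (R i))) T
        ≤ ENNReal.ofReal (Real.exp (∑ i, ε i))
            * Measure.pi (fun i => (M i x' : Measure (R i))) T
          + ENNReal.ofReal (∑ i, δ i) := by
  intro x x' hxx' T hT
  rw [Real.exp_sum, ENNReal.ofReal_prod_of_nonneg fun i _ => (Real.exp_pos (ε i)).le,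
    ENNReal.ofReal_sum_of_nonneg fun i _ => hδ i]
  exact Measure.pi_le_mul_add_of_forall_measure_le (fun i S hS => hdp i x x' hxx' S hS) hT
end

section
/- Let 𝒟 be a type equipped with a symmetric adjacency relation, and let A : 𝒟 → ℝ^{m×n}, b : 𝒟 → ℝ^m, c : 𝒟 → ℝ^n satisfy the sensitivity bounds: for all adjacent D, D′, ‖A(D) − A(D′)‖_{1,1} ≤ Δ_A, ‖b(D) − b(D′)‖₁ ≤ Δ_b, and ‖c(D) − c(D′)‖₁ ≤ Δ_c, with Δ_A, Δ_b, Δ_c > 0. Fix ε > 0, δ ∈ (0, 1/2], and privacy budget allocations α_A, α_b, α_c > 0 with α_A + α_b + α_c = 1. Let Z be an m×n random matrix with independent entries having the truncated Laplace density with scale Δ_A/(α_A ε) and support [−s_A, s_A] where s_A = (Δ_A/(α_A ε))·log(mn(e^{α_A ε} − 1)/(α_A δ) + 1); let z_b ∈ ℝ^m have independent coordinates with the truncated Laplace density with scale Δ_b/(α_b ε) and support [−s_b, s_b] where s_b = (Δ_b/(α_b ε))·log(m(e^{α_b ε} − 1)/(α_b δ) + 1); let z_c ∈ ℝ^n have independent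 coordinates with the Laplace density of scale Δ_c/(α_c ε); and let Z, z_b, z_c be mutually independent. Then the joint mechanism D ↦ law of (A(D) + Z, b(D) + z_b, c(D) + z_c) is (ε, δ)-differentially private: for all adjacent D, D′ and every Borel set T ⊆ ℝ^{m×n} × ℝ^m × ℝ^n, P[(A(D)+Z, b(D)+z_b, c(D)+z_c) ∈ T] ≤ e^ε·P[(A(D′)+Z, b(D′)+z_b, c(D′)+z_c) ∈ T] + δ. -/
open MeasureTheory

/-- The law of a real random variable with the (untruncated) Laplace density with scale `σ`. -/
noncomputable def lap (σ : ℝ) : Measure ℝ :=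
  volume.withDensity fun z => ENNReal.ofReal (Real.exp (-|z| / σ) / (2 * σ))

/-- `P` is bounded by `exp t • Q` on a measurable set whose complement has `P`-mass at most `d`. -/
def ApproxDominated {α : Type*} [MeasurableSpace α] (P Q : Measure α) (t d : ℝ) : Prop :=
  ∃ G, MeasurableSet G ∧ P.restrict G ≤ ENNReal.ofReal (Real.exp t) • Q ∧
    P Gᶜ ≤ ENNReal.ofReal d

namespace ApproxDominated

theorem mono {α : Type*} [MeasurableSpace α] {P Q : Measure α} {t t' d d' : ℝ}
    (h : ApproxDominated P Q t d) (ht : t ≤ t') (hd : d ≤ d') : ApproxDominated P Q t' d' := by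
  obtain ⟨G, hG, h1, h2⟩ := h
  refine ⟨G, hG, h1.trans ?_, h2.trans (ENNReal.ofReal_le_ofReal hd)⟩
  gcongr

theorem measure_le {α : Type*} [MeasurableSpace α] {P Q : Measure α} {t d : ℝ}
    (h : ApproxDominated P Q t d) {T : Set α} (hT : MeasurableSet T) :
    P T ≤ ENNReal.ofReal (Real.exp t) * Q T + ENNReal.ofReal d := by
  obtain ⟨G, hG, h1, h2⟩ := h
  calc P T ≤ P (T ∩ G) + P Gᶜ := by
        refine (measure_mono fun x hx => ?_).trans (measure_union_le _ _)
        by_cases hxG : x ∈ G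
        · exact Or.inl ⟨hx, hxG⟩
        · exact Or.inr hxG
    _ ≤ _ := by
        gcongr
        rw [← Measure.restrict_apply hT]
        exact h1 T

theorem prod {α β : Type*} [MeasurableSpace α] [MeasurableSpace β] {P Q : Measure α}
    {P' Q' : Measure β} [IsProbabilityMeasure P] [IsProbabilityMeasure P'] [IsFiniteMeasure Q]
    [IsFiniteMeasure Q'] {t t' d d' : ℝ} (hd : 0 ≤ d) (hd' : 0 ≤ d')
    (h : ApproxDominated P Q t d) (h' : ApproxDominated P' Q' t' d') :
    ApproxDominated (P.prod P') (Q.prod Q') (t + t') (d + d') := by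
  obtain ⟨G, hG, h1, h2⟩ := h
  obtain ⟨G', hG', h1', h2'⟩ := h'
  refine ⟨G ×ˢ G', hG.prod hG', ?_, ?_⟩
  · rw [← Measure.prod_restrict]
    have : IsFiniteMeasure (ENNReal.ofReal (Real.exp t') • Q') :=
      Measure.smul_finite _ ENNReal.ofReal_ne_top
    refine (Measure.prod_mono h1 h1').trans (le_of_eq ?_)
    rw [Measure.prod_smul_left, Measure.prod_smul_right, smul_smul, Real.exp_add,
      ENNReal.ofReal_mul (Real.exp_pos _).le]
  · calc (P.prod P') (G ×ˢ G')ᶜ ≤ (P.prod P') (Gᶜ ×ˢ Set.univ ∪ Set.univ ×ˢ G'ᶜ) := by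
          rw [Set.compl_prod_eq_union]
      _ ≤ P Gᶜ + P' G'ᶜ := by
          refine (measure_union_le _ _).trans ?_
          simp [Measure.prod_prod]
      _ ≤ _ := by
          rw [ENNReal.ofReal_add hd hd']
          gcongr

end ApproxDominated

/-- Finite product measures are monotone in their factors. -/
theorem measure_pi_mono {ι : Type*} [Fintype ι] {α : ι → Type*} [∀ i, MeasurableSpace (α i)]
    {μ ν : ∀ i, Measure (α i)} [∀ i, SigmaFinite (μ i)] (h : ∀ i, μ i ≤ ν i) :
    Measure.pi μ ≤ Measure.pi ν := by
  refine Measure.le_iff.2 fun s hs => ?_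
  simp only [Measure.pi]
  rw [toMeasure_apply _ _ hs, toMeasure_apply _ _ hs]
  refine OuterMeasure.le_pi.2 (fun t _ => ?_) s
  exact (OuterMeasure.pi_pi_le _ _).trans (Finset.prod_le_prod' fun i _ => h i (t i))

theorem measure_pi_smul {ι : Type*} [Fintype ι] {α : ι → Type*} [∀ i, MeasurableSpace (α i)]
    (Q : ∀ i, Measure (α i)) [∀ i, IsFiniteMeasure (Q i)] (κ : ι → ENNReal)
    (hκ : ∀ i, κ i ≠ ⊤) :
    Measure.pi (fun i => κ i • Q i) = (∏ i, κ i) • Measure.pi Q := by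
  have : ∀ i, IsFiniteMeasure (κ i • Q i) := fun i => Measure.smul_finite _ (hκ i)
  refine Measure.pi_eq fun s _ => ?_
  simp [Measure.pi_pi, Finset.prod_mul_distrib]

theorem ApproxDominated.pi {ι : Type*} [Fintype ι] {α : ι → Type*} [∀ i, MeasurableSpace (α i)]
    {P Q : ∀ i, Measure (α i)} [∀ i, IsProbabilityMeasure (P i)] [∀ i, IsFiniteMeasure (Q i)]
    {t d : ι → ℝ} (hd : ∀ i, 0 ≤ d i) (h : ∀ i, ApproxDominated (P i) (Q i) (t i) (d i)) :
    ApproxDominated (Measure.pi P) (Measure.pi Q) (∑ i, t i) (∑ i, d i) := by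
  choose G hG h1 h2 using h
  refine ⟨Set.univ.pi G, MeasurableSet.univ_pi hG, ?_, ?_⟩
  · rw [Measure.restrict_pi_pi]
    refine (measure_pi_mono h1).trans (le_of_eq ?_)
    rw [measure_pi_smul Q _ fun i => ENNReal.ofReal_ne_top, Real.exp_sum,
      ENNReal.ofReal_prod_of_nonneg fun i _ => (Real.exp_pos _).le]
  · have : (Set.univ.pi G)ᶜ ⊆ ⋃ i, Function.eval i ⁻¹' (G i)ᶜ := by
      intro x hx
      simpa [Set.mem_pi] using hx
    calc Measure.pi P (Set.univ.pi G)ᶜ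
        ≤ ∑ i, Measure.pi P (Function.eval i ⁻¹' (G i)ᶜ) :=
          (measure_mono this).trans (measure_iUnion_fintype_le _ _)
      _ = ∑ i, P i (G i)ᶜ := by
          refine Finset.sum_congr rfl fun i _ => ?_
          exact (measurePreserving_eval P i).measure_preimage (hG i).compl.nullMeasurableSet
      _ ≤ ∑ i, ENNReal.ofReal (d i) := Finset.sum_le_sum fun i _ => h2 i
      _ = _ := (ENNReal.ofReal_sum_of_nonneg fun i _ => hd i).symm

theorem map_add_left_withDensity {f : ℝ → ENNReal} (hf : Measurable f) (a : ℝ) :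
    (volume.withDensity f).map (a + ·) = volume.withDensity fun x => f (x - a) := by
  ext s hs
  rw [Measure.map_apply (measurable_const_add a) hs,
    withDensity_apply _ (measurable_const_add a hs), withDensity_apply _ hs,
    ← (measurePreserving_add_left volume a).setLIntegral_comp_preimage hs (by fun_prop)]
  simp

theorem approxDominated_withDensity_translate {f : ℝ → ENNReal} (hf : Measurable f)
    {a a' t d : ℝ} {G : Set ℝ} (hG : MeasurableSet G)
    (h : ∀ x ∈ G, f (x - a) ≤ ENNReal.ofReal (Real.exp t) * f (x - a'))
    (hd : volume.withDensity f {z | a + z ∉ G} ≤ ENNReal.ofReal d) :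
    ApproxDominated ((volume.withDensity f).map (a + ·)) ((volume.withDensity f).map (a' + ·))
      t d := by
  refine ⟨G, hG, ?_, ?_⟩
  · rw [map_add_left_withDensity hf, map_add_left_withDensity hf, restrict_withDensity hG,
      ← withDensity_smul _ (by fun_prop), ← withDensity_indicator hG]
    refine withDensity_mono (Filter.Eventually.of_forall fun x => ?_)
    by_cases hx : x ∈ G
    · simpa [hx] using h x hx
    · simp [hx]
  · rwa [Measure.map_apply (measurable_const_add a) hG.compl]

theorem withDensity_preimage_neg {f : ℝ → ENNReal} (hf : Measurable f) (heven : ∀ x, f (-x) = f x)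
    {S : Set ℝ} (hS : MeasurableSet S) :
    volume.withDensity f (Neg.neg ⁻¹' S) = volume.withDensity f S := by
  rw [withDensity_apply _ hS, withDensity_apply _ (measurable_neg hS),
    ← (Measure.measurePreserving_neg (volume : Measure ℝ)).setLIntegral_comp_preimage hS hf]
  simp [heven]

theorem withDensity_univ_of_even {f : ℝ → ENNReal} (hf : Measurable f)
    (heven : ∀ x, f (-x) = f x) :
    volume.withDensity f Set.univ = 2 * ∫⁻ x in Set.Ioi 0, f x := by
  rw [← Set.Iic_union_Ioi (a := (0 : ℝ)),
    measure_union (Set.Iic_disjoint_Ioi le_rfl) measurableSet_Ioi, two_mul,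
    ← withDensity_apply _ measurableSet_Ioi]
  congr 1
  rw [← withDensity_preimage_neg hf heven measurableSet_Ioi, withDensity_apply _ measurableSet_Iic,
    withDensity_apply _ (measurable_neg measurableSet_Ioi)]
  refine setLIntegral_congr ?_
  simpa using (Iio_ae_eq_Iic (a := (0 : ℝ)) (μ := volume)).symm

theorem isProbabilityMeasure_lap {σ : ℝ} (hσ : 0 < σ) : IsProbabilityMeasure (lap σ) := by
  refine ⟨?_⟩
  rw [lap, withDensity_univ_of_even (by fun_prop) (by simp)]
  have hneg : -σ⁻¹ < 0 := by simpa
  have hint : IntegrableOn (fun z : ℝ => (2 * σ)⁻¹ * Real.exp (-σ⁻¹ * z)) (Set.Ioi 0) :=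
    (integrableOn_exp_mul_Ioi hneg 0).const_mul _
  have : ∫⁻ z in Set.Ioi 0, ENNReal.ofReal (Real.exp (-|z| / σ) / (2 * σ)) =
      ∫⁻ z in Set.Ioi 0, ENNReal.ofReal ((2 * σ)⁻¹ * Real.exp (-σ⁻¹ * z)) := by
    refine setLIntegral_congr_fun measurableSet_Ioi fun z (hz : 0 < z) => ?_
    simp only [abs_of_pos hz]
    congr 1
    rw [div_eq_inv_mul]
    congr 2
    field_simp
  rw [this, ← ofReal_integral_eq_lintegral_ofReal hint
    (Filter.Eventually.of_forall fun z => by positivity), integral_const_mul,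
    integral_exp_mul_Ioi hneg, ← ENNReal.ofReal_ofNat 2, ← ENNReal.ofReal_mul (by norm_num),
    ← ENNReal.ofReal_one]
  congr 1
  simp
  field_simp

theorem truncLap_compl_Icc (σ s : ℝ) : truncLap σ s (Set.Icc (-s) s)ᶜ = 0 := by
  rw [truncLap, withDensity_apply _ measurableSet_Icc.compl,
    setLIntegral_congr_fun (g := fun _ => 0) measurableSet_Icc.compl fun z hz => ?_]
  · simp
  · have : ¬ |z| ≤ s := fun h => hz (abs_le.1 h)
    simp [truncLapPdf, this]

/-- Translating truncated Laplace noise by `v` moves little mass outside its support. -/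
theorem truncLap_translate_escape_le {σ s v d : ℝ} (hσ : 0 < σ) (hs : 0 < s) (hvs : |v| ≤ s)
    (hd : Real.exp (|v| / σ) - 1 ≤ 2 * d * (Real.exp (s / σ) - 1)) :
    truncLap σ s {z | ¬ |z + v| ≤ s} ≤ ENNReal.ofReal d := by
  wlog hv : 0 ≤ v generalizing v
  · have key := this (v := -v) (by rwa [abs_neg]) (by rwa [abs_neg]) (by linarith)
    refine le_of_eq_of_le ?_ key
    have hS : MeasurableSet {z : ℝ | ¬ |z + v| ≤ s} :=
      (measurableSet_le (f := fun z => |z + v|) (by fun_prop) measurable_const).compl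
    rw [truncLap, ← withDensity_preimage_neg (measurable_truncLapPdf σ s).ennreal_ofReal
      (by simp [truncLapPdf]) hS]
    congr 1
    ext z
    have : |(-z) + v| = |z + -v| := by rw [← abs_neg]; congr 1; ring
    simp [this]
  rw [abs_of_nonneg hv] at hvs hd
  have hsub : {z | ¬ |z + v| ≤ s} ⊆ Set.Ioc (s - v) s ∪ (Set.Icc (-s) s)ᶜ := by
    intro z hz
    by_cases hz' : z ∈ Set.Icc (-s) s
    · refine Or.inl ⟨?_, hz'.2⟩
      by_contra h
      exact hz (abs_le.2 ⟨by linarith [hz'.1], by linarith⟩)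
    · exact Or.inr hz'
  refine (measure_mono hsub).trans ((measure_union_le _ _).trans ?_)
  rw [truncLap_compl_Icc, add_zero, truncLap_Ioc hσ hs (by linarith) (by linarith)]
  refine ENNReal.ofReal_le_ofReal ?_
  have hgt : 1 < Real.exp (s / σ) := Real.one_lt_exp_iff.2 (by positivity)
  have hpos : 0 < Real.exp (s / σ) := Real.exp_pos _
  have e1 : Real.exp (-(s - v) / σ) = Real.exp (v / σ) / Real.exp (s / σ) := by
    rw [← Real.exp_sub]; congr 1; ring
  have e2 : Real.exp (-s / σ) = 1 / Real.exp (s / σ) := by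
    rw [neg_div, Real.exp_neg, one_div]
  rw [e1, e2]
  have : (Real.exp (v / σ) / Real.exp (s / σ) - 1 / Real.exp (s / σ)) /
      (2 * (1 - 1 / Real.exp (s / σ))) = (Real.exp (v / σ) - 1) / (2 * (Real.exp (s / σ) - 1)) := by
    have h1 : Real.exp (s / σ) - 1 ≠ 0 := by linarith
    field_simp
  rw [this, div_le_iff₀ (by linarith)]
  linarith

theorem exp_neg_abs_translate_le {σ : ℝ} (hσ : 0 < σ) (x a a' : ℝ) :
    Real.exp (-|x - a| / σ) ≤ Real.exp (|a - a'| / σ) * Real.exp (-|x - a'| / σ) := by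
  rw [← Real.exp_add, ← add_div]
  gcongr
  have := abs_sub_le x a a'
  linarith

theorem approxDominated_truncLap {σ s d : ℝ} (hσ : 0 < σ) (hs : 0 < s) {a a' : ℝ}
    (has : |a - a'| ≤ s)
    (hd : Real.exp (|a - a'| / σ) - 1 ≤ 2 * d * (Real.exp (s / σ) - 1)) :
    ApproxDominated ((truncLap σ s).map (a + ·)) ((truncLap σ s).map (a' + ·))
      (|a - a'| / σ) d := by
  have hlt : Real.exp (-s / σ) < 1 := Real.exp_lt_one_iff.2 (div_neg_of_neg_of_pos (by linarith) hσ)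
  have hE : 0 < 1 - Real.exp (-s / σ) := by linarith
  refine approxDominated_withDensity_translate (G := {x | |x - a'| ≤ s})
    (measurable_truncLapPdf σ s).ennreal_ofReal
    (measurableSet_le (by fun_prop) measurable_const) (fun x hx => ?_) ?_
  · rw [← ENNReal.ofReal_mul (Real.exp_pos _).le]
    refine ENNReal.ofReal_le_ofReal ?_
    have hx' : |x - a'| ≤ s := hx
    rw [truncLapPdf, truncLapPdf, if_pos hx', ← mul_div_assoc]
    split_ifs
    · gcongr
      exact exp_neg_abs_translate_le hσ x a a'
    · positivity
  · refine le_of_eq_of_le ?_ (truncLap_translate_escape_le hσ hs has hd)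
    rw [truncLap]
    congr 1
    ext z
    have : a + z - a' = z + (a - a') := by ring
    simp [this]

theorem approxDominated_lap {σ : ℝ} (hσ : 0 < σ) (a a' : ℝ) :
    ApproxDominated ((lap σ).map (a + ·)) ((lap σ).map (a' + ·)) (|a - a'| / σ) 0 := by
  refine approxDominated_withDensity_translate (G := Set.univ) (by fun_prop) MeasurableSet.univ
    (fun x _ => ?_) (by simp)
  rw [← ENNReal.ofReal_mul (Real.exp_pos _).le, ← mul_div_assoc]
  refine ENNReal.ofReal_le_ofReal ?_
  gcongr
  exact exp_neg_abs_translate_le hσ x a a'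

/-- With the support calibrated to `N` coordinates, each coordinate is private with failure
probability `δ / N`. -/
theorem approxDominated_truncLap_calibrated {Δ ε δ N s a a' : ℝ} (hΔ : 0 < Δ) (hε : 0 < ε)
    (hδ : 0 < δ) (hδN : δ ≤ N)
    (hs : s = Δ / ε * Real.log (N * (Real.exp ε - 1) / δ + 1)) (ha : |a - a'| ≤ Δ) :
    ApproxDominated ((truncLap (Δ / ε) s).map (a + ·)) ((truncLap (Δ / ε) s).map (a' + ·))
      (|a - a'| / (Δ / ε)) (δ / N) ∧ IsProbabilityMeasure (truncLap (Δ / ε) s) := by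
  have hσ : 0 < Δ / ε := by positivity
  have hN : 0 < N := hδ.trans_le hδN
  have hexp : 0 < Real.exp ε - 1 := by linarith [Real.add_one_lt_exp hε.ne']
  have hL : 0 < N * (Real.exp ε - 1) / δ + 1 := by positivity
  have hsσ : s / (Δ / ε) = Real.log (N * (Real.exp ε - 1) / δ + 1) := by
    rw [hs]; field_simp
  have hes : Real.exp (s / (Δ / ε)) - 1 = N * (Real.exp ε - 1) / δ := by
    rw [hsσ, Real.exp_log hL]; ring
  have hge : Real.exp ε - 1 ≤ N * (Real.exp ε - 1) / δ := by
    rw [le_div_iff₀ hδ, mul_comm]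
    gcongr
  have hΔs : Δ ≤ s := by
    have : ε ≤ s / (Δ / ε) := by
      rw [← Real.exp_le_exp]
      linarith
    rw [le_div_iff₀ hσ] at this
    calc Δ = ε * (Δ / ε) := by field_simp
      _ ≤ s := this
  have hs0 : 0 < s := hΔ.trans_le hΔs
  refine ⟨approxDominated_truncLap hσ hs0 (ha.trans hΔs) ?_, isProbabilityMeasure_truncLap hσ hs0⟩
  have h1 : |a - a'| / (Δ / ε) ≤ ε := by
    rw [div_le_iff₀ hσ]
    calc |a - a'| ≤ Δ := ha
      _ = ε * (Δ / ε) := by field_simp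
  have h2 := Real.exp_le_exp.2 h1
  have h3 : 2 * (δ / N) * (N * (Real.exp ε - 1) / δ) = 2 * (Real.exp ε - 1) := by field_simp
  rw [hes, h3]
  linarith

theorem map_add_left_pi {ι : Type*} [Fintype ι] {E : Type*} [MeasurableSpace E] [Add E]
    [MeasurableAdd E] (ν : Measure E) [IsProbabilityMeasure ν] (a : ι → E) :
    (Measure.pi fun _ => ν).map (a + ·) = Measure.pi fun i => ν.map (a i + ·) := by
  have (i : ι) : IsProbabilityMeasure (ν.map (a i + ·)) :=
    Measure.isProbabilityMeasure_map (measurable_const_add _).aemeasurable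
  exact Measure.pi_map_pi fun i => (measurable_const_add (a i)).aemeasurable

/-- The joint mechanism `D ↦ (A(D) + Z, b(D) + z_b, c(D) + z_c)`, adding independent
truncated-Laplace noise to `A`, truncated-Laplace noise to `b`, and Laplace noise to `c`,
with privacy budget allocations `αA, αb, αc`, is `(ε, δ)`-differentially private. -/
theorem joint_lp_mechanism_dp
    {𝒟 : Type*} (adj : 𝒟 → 𝒟 → Prop) (hadj : Symmetric adj)
    (m n : ℕ) (hm : 0 < m) (hn : 0 < n)
    (A : 𝒟 → Fin m → Fin n → ℝ) (b : 𝒟 → Fin m → ℝ) (c : 𝒟 → Fin n → ℝ)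
    (ΔA Δb Δc : ℝ) (hΔA : 0 < ΔA) (hΔb : 0 < Δb) (hΔc : 0 < Δc)
    (hsensA : ∀ D D', adj D D' → ∑ i, ∑ j, |A D i j - A D' i j| ≤ ΔA)
    (hsensb : ∀ D D', adj D D' → ∑ i, |b D i - b D' i| ≤ Δb)
    (hsensc : ∀ D D', adj D D' → ∑ i, |c D i - c D' i| ≤ Δc)
    (ε δ αA αb αc : ℝ) (hε : 0 < ε) (hδ0 : 0 < δ) (hδ : δ ≤ 1 / 2)
    (hαA : 0 < αA) (hαb : 0 < αb) (hαc : 0 < αc) (hα : αA + αb + αc = 1)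
    (sA sb : ℝ)
    (hsA : sA = ΔA / (αA * ε)
      * Real.log ((m * n : ℝ) * (Real.exp (αA * ε) - 1) / (αA * δ) + 1))
    (hsb : sb = Δb / (αb * ε)
      * Real.log ((m : ℝ) * (Real.exp (αb * ε) - 1) / (αb * δ) + 1))
    (μ : Measure ((Fin m → Fin n → ℝ) × (Fin m → ℝ) × (Fin n → ℝ)))
    (hμ : μ = (Measure.pi fun _ : Fin m => Measure.pi fun _ : Fin n =>
                truncLap (ΔA / (αA * ε)) sA).prod
              ((Measure.pi fun _ : Fin m => truncLap (Δb / (αb * ε)) sb).prod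
               (Measure.pi fun _ : Fin n => lap (Δc / (αc * ε)))))
    (D D' : 𝒟) (hDD' : adj D D')
    (T : Set ((Fin m → Fin n → ℝ) × (Fin m → ℝ) × (Fin n → ℝ)))
    (hT : MeasurableSet T) :
    μ {w | (A D + w.1, b D + w.2.1, c D + w.2.2) ∈ T}
      ≤ ENNReal.ofReal (Real.exp ε)
          * μ {w | (A D' + w.1, b D' + w.2.1, c D' + w.2.2) ∈ T}
        + ENNReal.ofReal δ := by
  have hA0 : 0 < αA * ε := by positivity
  have hb0 : 0 < αb * ε := by positivity
  have hc0 : 0 < αc * ε := by positivity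
  have hm1 : (1 : ℝ) ≤ m := by exact_mod_cast hm
  have hn1 : (1 : ℝ) ≤ n := by exact_mod_cast hn
  have hmn1 : (1 : ℝ) ≤ m * n := one_le_mul_of_one_le_of_one_le hm1 hn1
  have hAδ : αA * δ ≤ 1 := by nlinarith
  have hbδ : αb * δ ≤ 1 := by nlinarith
  have hA (i j) : |A D i j - A D' i j| ≤ ΔA :=
    calc |A D i j - A D' i j| ≤ ∑ j, |A D i j - A D' i j| :=
          Finset.single_le_sum (f := fun j => |A D i j - A D' i j|) (fun _ _ => abs_nonneg _)
            (Finset.mem_univ j)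
      _ ≤ ∑ i, ∑ j, |A D i j - A D' i j| :=
          Finset.single_le_sum (f := fun i => ∑ j, |A D i j - A D' i j|)
            (fun _ _ => Finset.sum_nonneg fun _ _ => abs_nonneg _) (Finset.mem_univ i)
      _ ≤ ΔA := hsensA D D' hDD'
  have hb (i) : |b D i - b D' i| ≤ Δb :=
    (Finset.single_le_sum (f := fun i => |b D i - b D' i|) (fun _ _ => abs_nonneg _)
      (Finset.mem_univ i)).trans (hsensb D D' hDD')
  have domA (i j) := approxDominated_truncLap_calibrated hΔA hA0 (mul_pos hαA hδ0)
    (hAδ.trans hmn1) hsA (hA i j)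
  have domb (i) := approxDominated_truncLap_calibrated hΔb hb0 (mul_pos hαb hδ0)
    (hbδ.trans hm1) hsb (hb i)
  have : IsProbabilityMeasure (truncLap (ΔA / (αA * ε)) sA) := (domA ⟨0, hm⟩ ⟨0, hn⟩).2
  have : IsProbabilityMeasure (truncLap (Δb / (αb * ε)) sb) := (domb ⟨0, hm⟩).2
  have : IsProbabilityMeasure (lap (Δc / (αc * ε))) := isProbabilityMeasure_lap (by positivity)
  have isProb {E : Type} [MeasurableSpace E] [Add E] [MeasurableAdd E] (ν : Measure E)
      [IsProbabilityMeasure ν] (x : E) : IsProbabilityMeasure (ν.map (x + ·)) :=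
    Measure.isProbabilityMeasure_map (measurable_const_add _).aemeasurable
  have h1 : ApproxDominated
      ((Measure.pi fun _ : Fin m => Measure.pi fun _ : Fin n =>
        truncLap (ΔA / (αA * ε)) sA).map (A D + ·))
      ((Measure.pi fun _ : Fin m => Measure.pi fun _ : Fin n =>
        truncLap (ΔA / (αA * ε)) sA).map (A D' + ·)) (αA * ε) (αA * δ) := by
    simp only [map_add_left_pi]
    refine (ApproxDominated.pi (fun i => ?_) fun i => ApproxDominated.pi (fun j => ?_)
      fun j => (domA i j).1).mono ?_ ?_
    · positivity
    · positivity
    · simp only [← Finset.sum_div]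
      rw [div_le_iff₀ (by positivity)]
      refine (hsensA D D' hDD').trans (le_of_eq ?_)
      field_simp
    · refine le_of_eq ?_
      simp only [Finset.sum_const, Finset.card_univ, Fintype.card_fin, nsmul_eq_mul]
      field_simp
  have h2 : ApproxDominated
      ((Measure.pi fun _ : Fin m => truncLap (Δb / (αb * ε)) sb).map (b D + ·))
      ((Measure.pi fun _ : Fin m => truncLap (Δb / (αb * ε)) sb).map (b D' + ·))
      (αb * ε) (αb * δ) := by
    simp only [map_add_left_pi]
    refine (ApproxDominated.pi (fun i => ?_) fun i => (domb i).1).mono ?_ ?_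
    · positivity
    · rw [← Finset.sum_div, div_le_iff₀ (by positivity)]
      refine (hsensb D D' hDD').trans (le_of_eq ?_)
      field_simp
    · refine le_of_eq ?_
      simp only [Finset.sum_const, Finset.card_univ, Fintype.card_fin, nsmul_eq_mul]
      field_simp
  have h3 : ApproxDominated
      ((Measure.pi fun _ : Fin n => lap (Δc / (αc * ε))).map (c D + ·))
      ((Measure.pi fun _ : Fin n => lap (Δc / (αc * ε))).map (c D' + ·)) (αc * ε) 0 := by
    simp only [map_add_left_pi]
    refine (ApproxDominated.pi (fun _ => le_rfl) fun i =>
      approxDominated_lap (by positivity) (c D i) (c D' i)).mono ?_ (by simp)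
    rw [← Finset.sum_div, div_le_iff₀ (by positivity)]
    refine (hsensc D D' hDD').trans (le_of_eq ?_)
    field_simp
  have hmap (E : 𝒟) : μ {w | (A E + w.1, b E + w.2.1, c E + w.2.2) ∈ T} =
      (((Measure.pi fun _ : Fin m => Measure.pi fun _ : Fin n =>
        truncLap (ΔA / (αA * ε)) sA).map (A E + ·)).prod
      (((Measure.pi fun _ : Fin m => truncLap (Δb / (αb * ε)) sb).map (b E + ·)).prod
      ((Measure.pi fun _ : Fin n => lap (Δc / (αc * ε))).map (c E + ·)))) T := by
    rw [Measure.map_prod_map _ _ (measurable_const_add _) (measurable_const_add _),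
      Measure.map_prod_map _ _ (measurable_const_add _) (by fun_prop),
      Measure.map_apply (by fun_prop) hT, hμ]
    rfl
  rw [hmap D, hmap D']
  refine ((h1.prod (by positivity) (by positivity)
    (h2.prod (by positivity) le_rfl h3)).mono (le_of_eq ?_) ?_).measure_le hT
  · rw [← add_mul, ← add_mul, ← add_assoc, hα, one_mul]
  · nlinarith
end

section
/- Let ε > 0, δ ∈ (0, 1/2], Δ > 0, and let m, n be positive integers. Set σ = Δ/ε, s = σ·log(mn(e^ε − 1)/δ + 1), and ζ = 2σ(1 − e^{−s/σ}). Then Δ ≤ s, and the total normalized mass of the two boundary strips of width Δ of the truncated Laplace density, multiplied by mn, equals exactly δ: (mn/ζ)·( ∫_{−s}^{−s+Δ} e^{−|z|/σ} dz + ∫_{s−Δ}^{s} e^{−|z|/σ} dz ) = δ. -/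
theorem integral_exp_neg_abs_div_of_nonneg {σ a b : ℝ} (hσ : σ ≠ 0) (ha : 0 ≤ a) (hab : a ≤ b) :
    ∫ z in a..b, Real.exp (-|z| / σ) = σ * (Real.exp (-a / σ) - Real.exp (-b / σ)) := by
  have hcongr : ∫ z in a..b, Real.exp (-|z| / σ) = ∫ z in a..b, Real.exp (-z / σ) := by
    refine intervalIntegral.integral_congr fun z hz => ?_
    rw [Set.uIcc_of_le hab] at hz
    simp only [abs_of_nonneg (ha.trans hz.1)]
  have hderiv (z : ℝ) :
      HasDerivAt (fun x => -σ * Real.exp (-x / σ)) (Real.exp (-z / σ)) z := by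
    have h := ((hasDerivAt_neg z).div_const σ).exp.const_mul (-σ)
    have hval : -σ * (Real.exp (-z / σ) * (-1 / σ)) = Real.exp (-z / σ) := by field_simp
    rwa [hval] at h
  rw [hcongr, intervalIntegral.integral_eq_sub_of_hasDerivAt (fun z _ => hderiv z)
    (Continuous.intervalIntegrable (by fun_prop) _ _)]
  ring

theorem integral_exp_neg_abs_div_neg (σ a b : ℝ) :
    ∫ z in (-b)..(-a), Real.exp (-|z| / σ) = ∫ z in a..b, Real.exp (-|z| / σ) := by
  rw [← intervalIntegral.integral_comp_neg]
  simp only [abs_neg]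

/-- For the truncated Laplace mechanism parameters `σ = Δ/ε` and
`s = σ · log (mn(e^ε − 1)/δ + 1)`, one has `Δ ≤ s`, and the total normalized mass of
the two boundary strips of width `Δ` of the truncated Laplace density, multiplied by
`mn`, equals exactly `δ`. -/
theorem truncated_laplace_boundary_mass
    (ε δ Δ : ℝ) (hε : 0 < ε) (hδ0 : 0 < δ) (hδ : δ ≤ 1 / 2) (hΔ : 0 < Δ)
    (m n : ℕ) (hm : 0 < m) (hn : 0 < n)
    (σ s ζ : ℝ) (hσ : σ = Δ / ε)
    (hs : s = σ * Real.log ((m * n : ℝ) * (Real.exp ε - 1) / δ + 1))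
    (hζ : ζ = 2 * σ * (1 - Real.exp (-s / σ))) :
    Δ ≤ s ∧
    (m * n : ℝ) / ζ *
        ((∫ z in (-s)..(-s + Δ), Real.exp (-|z| / σ))
          + ∫ z in (s - Δ)..s, Real.exp (-|z| / σ)) = δ := by
  have hσ_pos : 0 < σ := hσ ▸ div_pos hΔ hε
  have hΔ_eq : Δ = σ * ε := by rw [hσ]; field_simp
  have hN : (1 : ℝ) ≤ m * n := by exact_mod_cast Nat.mul_pos hm hn
  have hE : 0 < Real.exp ε - 1 := sub_pos.2 (Real.one_lt_exp_iff.2 hε)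
  set N : ℝ := m * n
  set A : ℝ := N * (Real.exp ε - 1) / δ + 1 with hA
  have hN_pos : 0 < N := one_pos.trans_le hN
  have hA_pos : 0 < A := by positivity
  have hexp_le : Real.exp ε ≤ A := by
    have : Real.exp ε - 1 ≤ N * (Real.exp ε - 1) / δ := by
      rw [le_div_iff₀ hδ0]
      nlinarith
    linarith
  have hΔs : Δ ≤ s := by
    rw [hΔ_eq, hs]
    exact mul_le_mul_of_nonneg_left ((Real.le_log_iff_exp_le hA_pos).2 hexp_le) hσ_pos.le
  refine ⟨hΔs, ?_⟩
  have hexp_s : Real.exp (-s / σ) = A⁻¹ := by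
    rw [hs, neg_div, mul_div_cancel_left₀ _ hσ_pos.ne', Real.exp_neg, Real.exp_log hA_pos]
  have hexp_sub : Real.exp (-(s - Δ) / σ) = Real.exp ε * A⁻¹ := by
    rw [← hexp_s, ← Real.exp_add, hΔ_eq]
    congr 1
    field_simp
    ring
  have hneg : -s + Δ = -(s - Δ) := by ring
  rw [hneg, integral_exp_neg_abs_div_neg,
    integral_exp_neg_abs_div_of_nonneg hσ_pos.ne' (sub_nonneg.2 hΔs) (sub_le_self _ hΔ.le),
    hζ, hexp_sub, hexp_s]
  have hA_sub : A - 1 = N * (Real.exp ε - 1) / δ := by rw [hA]; ring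
  have hcompl : 1 - A⁻¹ = N * (Real.exp ε - 1) / δ * A⁻¹ := by
    rw [← hA_sub]
    field_simp
  rw [hcompl]
  clear_value A
  field_simp
  ring
end
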